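/- Let X be a second countable, locally compact Hausdorff space and H_X an X-module. For every T ∈ RL*_c(H_X) and every φ ∈ C₀(X): the pointwise products φT and Tφ lie in RL*_c(H_X); the commutator t ↦ [φ, T_t] lies in C₀([1,∞), 𝒦(H_X)); and for every ε > 0 there exists φ ∈ C₀(X) with ‖φT − T‖ < ε. Consequently, the quotient RL*_{c,Q}(H_X) = RL*_c(H_X) / C₀([1,∞), 𝒦(H_X)) is a C₀(X)-algebra: the induced representation of C₀(X) on the multiplier algebra of the quotient is nondegenerate and central. -/

import Mathlib

open scoped ZeroAtInfty
open Filter Topology MeasureTheory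

noncomputable section

namespace Stmt

variable {X : Type*} [TopologicalSpace X]
variable {H : Type*} [NormedAddCommGroup H] [InnerProductSpace ℂ H] [CompleteSpace H]

/-- `π` is a nondegenerate ⋆-representation of `C₀(X, ℂ)` on the Hilbert space `H`,
i.e. `H` is an `X`-module. -/
structure IsStarRep (π : C₀(X, ℂ) → H →L[ℂ] H) : Prop where
  map_add : ∀ φ ψ, π (φ + ψ) = π φ + π ψ
  map_smul : ∀ (a : ℂ) (φ), π (a • φ) = a • π φ
  map_mul : ∀ φ ψ, π (φ * ψ) = (π φ).comp (π ψ)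
  map_star : ∀ φ, ContinuousLinearMap.adjoint (π φ) = π (star φ)
  nondeg : Dense (↑(Submodule.span ℂ (Set.range fun p : C₀(X, ℂ) × H => π p.1 p.2)) : Set H)

/-- The support of an operator `T` on an `X`-module: the set of pairs `(y, x) ∈ X × X`
near which `T` does not vanish. -/
def opSupport (π : C₀(X, ℂ) → H →L[ℂ] H) (T : H →L[ℂ] H) : Set (X × X) :=
  {p | ∀ U V : Set X, IsOpen U → IsOpen V → p.2 ∈ U → p.1 ∈ V →
      ∃ φ ψ : C₀(X, ℂ), tsupport ⇑φ ⊆ U ∧ tsupport ⇑ψ ⊆ V ∧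
        (π ψ).comp (T.comp (π φ)) ≠ 0}

/-- The function `x ↦ f x - f ∞` on `X`, for `f` a continuous function on the one-point
compactification of `X`; it vanishes at infinity. -/
def onePointRestrict (f : C(OnePoint X, ℂ)) : C₀(X, ℂ) where
  toFun x := f x - f OnePoint.infty
  continuous_toFun := (f.continuous.comp OnePoint.continuous_coe).sub continuous_const
  zero_at_infty' := by
    have h1 : Tendsto ((↑) : X → OnePoint X) (cocompact X) (𝓝 (OnePoint.infty)) :=
      OnePoint.tendsto_coe_infty.mono_left cocompact_le_coclosedCompact
    have h2 : Tendsto (fun x : X => f x - f OnePoint.infty) (cocompact X)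
        (𝓝 (f OnePoint.infty - f OnePoint.infty)) :=
      ((f.continuous.tendsto _).comp h1).sub tendsto_const_nhds
    simpa using h2

/-- The canonical action of `C(X⁺, ℂ)` on an `X`-module, extending the action of
`C₀(X, ℂ)` unitally (`X⁺` being the one-point compactification of `X`). -/
def onePointAct (π : C₀(X, ℂ) → H →L[ℂ] H) (f : C(OnePoint X, ℂ)) : H →L[ℂ] H :=
  f OnePoint.infty • (1 : H →L[ℂ] H) + π (onePointRestrict f)

/-- The support of an operator on an `X`-module, viewed as a module over the one-point
compactification `X⁺`. -/
def opSupportPlus (π : C₀(X, ℂ) → H →L[ℂ] H) (T : H →L[ℂ] H) :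
    Set (OnePoint X × OnePoint X) :=
  {p | ∀ U V : Set (OnePoint X), IsOpen U → IsOpen V → p.2 ∈ U → p.1 ∈ V →
      ∃ f g : C(OnePoint X, ℂ), tsupport ⇑f ⊆ U ∧ tsupport ⇑g ⊆ V ∧
        (onePointAct π g).comp (T.comp (onePointAct π f)) ≠ 0}

/-- A family of operators indexed by `[1, ∞)` (modelled on `ℝ`) is bounded in norm. -/
def OpBdd (T : ℝ → H →L[ℂ] H) : Prop :=
  ∃ C : ℝ, ∀ t : ℝ, 1 ≤ t → ‖T t‖ ≤ C

/-- `lim_{t → ∞} ‖[φ, T_t]‖ = 0` for every `φ ∈ C₀(X)`. -/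
def CommDecay (π : C₀(X, ℂ) → H →L[ℂ] H) (T : ℝ → H →L[ℂ] H) : Prop :=
  ∀ φ : C₀(X, ℂ),
    Tendsto (fun t => ‖(π φ).comp (T t) - (T t).comp (π φ)‖) atTop (𝓝 0)

/-- The supports of the `T_t`, viewed in `X⁺ × X⁺`, are eventually contained in any given
open neighbourhood of the diagonal. -/
def SmallSuppPlus (π : C₀(X, ℂ) → H →L[ℂ] H) (S : ℝ → H →L[ℂ] H) : Prop :=
  ∀ U : Set (OnePoint X × OnePoint X), IsOpen U → (∀ z, (z, z) ∈ U) →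
    ∃ tU : ℝ, 1 ≤ tU ∧ ∀ t > tU, opSupportPlus π (S t) ⊆ U

/-- Uniform closure (over `[1, ∞)`, in the sup-norm) of a set of operator-valued
functions; this is the norm closure inside `C_b([1,∞), 𝒦(H))` when applied to sets of
bounded continuous compact-operator valued functions. -/
def UnifClosure (A : Set (ℝ → H →L[ℂ] H)) : Set (ℝ → H →L[ℂ] H) :=
  {T | ∀ ε > (0 : ℝ), ∃ S ∈ A, ∀ t : ℝ, 1 ≤ t → ‖T t - S t‖ ≤ ε}

/-- The ⋆-algebra `RL^{alg}_c(H_X)`: bounded, norm-continuous, compact-operator valued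
functions on `[1, ∞)` with uniform compact support and commutator decay. -/
def RLalg (π : C₀(X, ℂ) → H →L[ℂ] H) : Set (ℝ → H →L[ℂ] H) :=
  {T | OpBdd T ∧ ContinuousOn T (Set.Ici 1) ∧
    (∀ t : ℝ, 1 ≤ t → IsCompactOperator ⇑(T t)) ∧
    (∃ K : Set X, IsCompact K ∧ ∀ t : ℝ, 1 ≤ t → opSupport π (T t) ⊆ K ×ˢ K) ∧
    CommDecay π T}

/-- The representable localization algebra `RL^*_c(H_X)` (as a set of operator-valued
functions on `[1, ∞)`): the uniform closure of `RL^{alg}_c(H_X)`. -/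
def RLc (π : C₀(X, ℂ) → H →L[ℂ] H) : Set (ℝ → H →L[ℂ] H) :=
  UnifClosure (RLalg π)

section CutOff

/-- A compactly supported real function, viewed as an element of `C₀(X, ℂ)`. -/
def cutoff (f : C(X, ℝ)) (hf : HasCompactSupport f) : C₀(X, ℂ) where
  toFun x := (f x : ℂ)
  continuous_toFun := Complex.continuous_ofReal.comp f.continuous
  zero_at_infty' := by
    have h : HasCompactSupport fun x => (f x : ℂ) := hf.comp_left (g := Complex.ofReal) (by simp)
    exact h.is_zero_at_infty

@[simp]
lemma cutoff_apply (f : C(X, ℝ)) (hf : HasCompactSupport f) (x : X) :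
    cutoff f hf x = (f x : ℂ) := rfl

lemma tsupport_cutoff_subset (f : C(X, ℝ)) (hf : HasCompactSupport f) :
    tsupport (cutoff f hf) ⊆ tsupport f :=
  closure_mono fun x hx => by
    simpa [Function.mem_support] using hx

lemma tsupport_mul_subset_left' (φ ψ : C₀(X, ℂ)) : tsupport (φ * ψ) ⊆ tsupport φ :=
  tsupport_mul_subset_left (f := φ) (g := ψ)

lemma tsupport_mul_subset_right' (φ ψ : C₀(X, ℂ)) : tsupport (φ * ψ) ⊆ tsupport ψ :=
  tsupport_mul_subset_right (f := φ) (g := ψ)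

lemma norm_le_of_forall_le {φ : C₀(X, ℂ)} {C : ℝ} (hC : 0 ≤ C) (h : ∀ x, ‖φ x‖ ≤ C) :
    ‖φ‖ ≤ C := by
  rw [← ZeroAtInftyContinuousMap.norm_toBCF_eq_norm]
  exact (BoundedContinuousFunction.norm_le hC).2 h

lemma norm_cutoff_le_one (f : C(X, ℝ)) (hf : HasCompactSupport f)
    (h01 : ∀ x, f x ∈ Set.Icc (0 : ℝ) 1) : ‖cutoff f hf‖ ≤ 1 :=
  norm_le_of_forall_le zero_le_one fun x => by
    simpa [abs_of_nonneg (h01 x).1] using (h01 x).2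

lemma sum_apply' {ι : Type*} (t : Finset ι) (g : ι → C₀(X, ℂ)) (x : X) :
    (∑ i ∈ t, g i) x = ∑ i ∈ t, g i x := by
  classical
  induction t using Finset.induction_on with
  | empty => simp
  | insert a s ha ih => simp [Finset.sum_insert ha, ih]

variable [T2Space X] [LocallyCompactSpace X]

/-- A function supported in a compact set `K` is a finite sum of functions subordinate to a
given open cover of `K`, the finite index set depending only on `K` and the cover. -/
lemma exists_finset_sum_subordinate {K : Set X} (hK : IsCompact K) (U : X → Set X)
    (hU : ∀ x ∈ K, IsOpen (U x)) (hxU : ∀ x ∈ K, x ∈ U x) :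
    ∃ t : Finset X, (∀ x ∈ t, x ∈ K) ∧ ∀ φ : C₀(X, ℂ), tsupport φ ⊆ K →
      ∃ g : t → C₀(X, ℂ), φ = ∑ x, g x ∧ ∀ x : t, tsupport (g x) ⊆ U x := by
  obtain ⟨t, htK, hKt⟩ := hK.elim_nhds_subcover U fun x hx => (hU x hx).mem_nhds (hxU x hx)
  refine ⟨t, htK, fun φ hφ => ?_⟩
  obtain ⟨f, hfU, hf1, -, hfc⟩ := exists_continuous_sum_one_of_isOpen_isCompact
    (s := fun i => U (t.equivFin.symm i)) (fun i => hU _ (htK _ (t.equivFin.symm i).2)) hK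
    (fun x hx => by
      obtain ⟨y, hy, hxy⟩ := Set.mem_iUnion₂.1 (hKt hx)
      exact Set.mem_iUnion.2 ⟨t.equivFin ⟨y, hy⟩, by simpa using hxy⟩)
  refine ⟨fun x => cutoff (f (t.equivFin x)) (hfc _) * φ, ?_, fun x => ?_⟩
  · ext x
    rw [sum_apply', t.equivFin.sum_comp (fun i => (cutoff (f i) (hfc i) * φ) x)]
    by_cases hx : x ∈ K
    · have h1 : ∑ i, f i x = 1 := by simpa using hf1 hx
      have h2 : ∑ i, (f i x : ℂ) = 1 := by exact_mod_cast h1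
      simp [← Finset.sum_mul, h2]
    · have : φ x = 0 := image_eq_zero_of_notMem_tsupport fun h => hx (hφ h)
      simp [this]
  · refine (tsupport_mul_subset_left' _ _).trans ((tsupport_cutoff_subset _ _).trans ?_)
    simpa using hfU (t.equivFin x)

lemma mem_closure_compactSupport (φ : C₀(X, ℂ)) :
    φ ∈ closure {ψ : C₀(X, ℂ) | HasCompactSupport ψ ∧ tsupport ψ ⊆ tsupport φ} := by
  rw [Metric.mem_closure_iff]
  intro ε hε
  have h0 : ∀ᶠ x in cocompact X, ‖φ x‖ < ε / 2 := by
    have := φ.zero_at_infty'.norm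
    simp only [norm_zero] at this
    exact this.eventually_lt_const (half_pos hε)
  obtain ⟨K, hK, hKφ⟩ := mem_cocompact.1 h0
  obtain ⟨f, hf1, -, hfc, hf01⟩ := exists_continuous_one_zero_of_isCompact hK isClosed_empty
    (Set.disjoint_empty K)
  refine ⟨cutoff f hfc * φ, ⟨hfc.of_isClosed_subset (isClosed_tsupport _)
    ((tsupport_mul_subset_left' _ _).trans (tsupport_cutoff_subset _ _)),
    tsupport_mul_subset_right' _ _⟩, ?_⟩
  rw [dist_eq_norm]
  refine (norm_le_of_forall_le (half_pos hε).le fun x => ?_).trans_lt (half_lt_self hε)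
  have hx : (φ - cutoff f hfc * φ) x = ((1 - f x : ℝ) : ℂ) * φ x := by
    simp [sub_mul]
  rw [hx, norm_mul, Complex.norm_real, Real.norm_of_nonneg (by linarith [(hf01 x).2])]
  by_cases hxK : x ∈ K
  · simpa [hf1 hxK] using (half_pos hε).le
  · have h1 : ‖φ x‖ < ε / 2 := hKφ hxK
    nlinarith [norm_nonneg (φ x), (hf01 x).1]

end CutOff

namespace IsStarRep

variable {π : C₀(X, ℂ) → H →L[ℂ] H}

/-- An `X`-module structure as a homomorphism of ⋆-algebras. -/
def toStarAlgHom (hπ : IsStarRep π) : C₀(X, ℂ) →⋆ₙₐ[ℂ] (H →L[ℂ] H) where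
  toFun := π
  map_smul' := hπ.map_smul
  map_zero' := by simpa using hπ.map_smul 0 0
  map_add' := hπ.map_add
  map_mul' := hπ.map_mul
  map_star' φ := (hπ.map_star φ).symm

lemma norm_apply_le (hπ : IsStarRep π) (φ : C₀(X, ℂ)) : ‖π φ‖ ≤ ‖φ‖ :=
  NonUnitalStarAlgHom.norm_apply_le hπ.toStarAlgHom φ

lemma map_sub (hπ : IsStarRep π) (φ ψ : C₀(X, ℂ)) : π (φ - ψ) = π φ - π ψ :=
  _root_.map_sub hπ.toStarAlgHom φ ψ

lemma map_sum (hπ : IsStarRep π) {ι : Type*} (t : Finset ι) (g : ι → C₀(X, ℂ)) :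
    π (∑ i ∈ t, g i) = ∑ i ∈ t, π (g i) :=
  _root_.map_sum hπ.toStarAlgHom g t

lemma continuous (hπ : IsStarRep π) : Continuous π :=
  AddMonoidHomClass.continuous_of_bound hπ.toStarAlgHom 1
    (by simpa using! hπ.norm_apply_le)

lemma comp_comm (hπ : IsStarRep π) (φ ψ : C₀(X, ℂ)) :
    (π φ).comp (π ψ) = (π ψ).comp (π φ) := by
  rw [← hπ.map_mul, ← hπ.map_mul, mul_comm]

lemma eq_zero_of_comp_eq_zero (hπ : IsStarRep π) {B : H →L[ℂ] H}
    (h : ∀ χ, B.comp (π χ) = 0) : B = 0 := by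
  refine ContinuousLinearMap.ext_on hπ.nondeg ?_
  rintro _ ⟨⟨χ, v⟩, rfl⟩
  exact DFunLike.congr_fun (h χ) v

lemma eq_zero_of_comp_comp_eq_zero (hπ : IsStarRep π) {A : H →L[ℂ] H}
    (h : ∀ χ χ', (π χ).comp (A.comp (π χ')) = 0) : A = 0 := by
  have h1 : ∀ χ, (π χ).comp A = 0 := fun χ => hπ.eq_zero_of_comp_eq_zero (h χ)
  have h2 : ContinuousLinearMap.adjoint A = 0 := hπ.eq_zero_of_comp_eq_zero fun χ => by
    have := congrArg ContinuousLinearMap.adjoint (h1 (star χ))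
    rwa [ContinuousLinearMap.adjoint_comp, hπ.map_star, star_star, map_zero] at this
  simpa using h2

variable [T2Space X] [LocallyCompactSpace X]

lemma comp_comp_eq_zero_of_isCompact (hπ : IsStarRep π) {S : H →L[ℂ] H} {K L : Set X}
    (hK : IsCompact K) (hL : IsCompact L) (hKL : ∀ y ∈ K, ∀ x ∈ L, (y, x) ∉ opSupport π S)
    {φ ψ : C₀(X, ℂ)} (hφ : tsupport φ ⊆ L) (hψ : tsupport ψ ⊆ K) :
    (π ψ).comp (S.comp (π φ)) = 0 := by
  have hloc : ∀ y ∈ K, ∃ V, IsOpen V ∧ y ∈ V ∧ ∀ ψ : C₀(X, ℂ), tsupport ψ ⊆ V →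
      (π ψ).comp (S.comp (π φ)) = 0 := by
    intro y hy
    have hUV : ∀ x ∈ L, ∃ U V : Set X, IsOpen U ∧ IsOpen V ∧ x ∈ U ∧ y ∈ V ∧
        ∀ φ ψ : C₀(X, ℂ), tsupport φ ⊆ U → tsupport ψ ⊆ V →
          (π ψ).comp (S.comp (π φ)) = 0 := by
      intro x hx
      have := hKL y hy x hx
      simp only [opSupport, Set.mem_ofPred_eq] at this
      push Not at this
      exact this
    choose! U V hU hV hxU hyV hz using hUV
    obtain ⟨t, htL, hsum⟩ := exists_finset_sum_subordinate hL U hU hxU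
    refine ⟨⋂ x : t, V x, isOpen_iInter_of_finite fun x => hV x (htL x x.2),
      Set.mem_iInter.2 fun x => hyV x (htL x x.2), fun ψ hψ => ?_⟩
    obtain ⟨g, hg, hgU⟩ := hsum φ hφ
    rw [hg, hπ.map_sum, ContinuousLinearMap.comp_finsetSum, ContinuousLinearMap.comp_finsetSum]
    exact Finset.sum_eq_zero fun x _ =>
      hz x (htL x x.2) _ _ (hgU x) (hψ.trans (Set.iInter_subset _ x))
  choose! V hV hyV hz using hloc
  obtain ⟨t, htK, hsum⟩ := exists_finset_sum_subordinate hK V hV hyV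
  obtain ⟨g, hg, hgV⟩ := hsum ψ hψ
  rw [hg, hπ.map_sum, ContinuousLinearMap.finsetSum_comp]
  exact Finset.sum_eq_zero fun x _ => hz x (htK x x.2) _ (hgV x)

lemma comp_comp_eq_zero (hπ : IsStarRep π) {S : H →L[ℂ] H} {φ ψ : C₀(X, ℂ)}
    (h : ∀ y ∈ tsupport ψ, ∀ x ∈ tsupport φ, (y, x) ∉ opSupport π S) :
    (π ψ).comp (S.comp (π φ)) = 0 := by
  have hcpt : ∀ ψ' ∈ {ψ' : C₀(X, ℂ) | HasCompactSupport ψ' ∧ tsupport ψ' ⊆ tsupport ψ},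
      (π ψ').comp (S.comp (π φ)) = 0 := by
    rintro ψ' ⟨hc, hs⟩
    have hcl : IsClosed {φ' : C₀(X, ℂ) | (π ψ').comp (S.comp (π φ')) = 0} :=
      isClosed_eq (continuous_const.clm_comp (continuous_const.clm_comp hπ.continuous))
        continuous_const
    exact closure_minimal (fun φ' hφ' => hπ.comp_comp_eq_zero_of_isCompact hc hφ'.1
      (fun y hy x hx => h y (hs hy) x (hφ'.2 hx)) subset_rfl subset_rfl) hcl
      (mem_closure_compactSupport φ)
  have hcl : IsClosed {ψ' : C₀(X, ℂ) | (π ψ').comp (S.comp (π φ)) = 0} :=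
    isClosed_eq (hπ.continuous.clm_comp continuous_const) continuous_const
  exact closure_minimal hcpt hcl (mem_closure_compactSupport ψ)

/-- A compact set has a contractive unit for all operators with support in it. -/
lemma exists_comp_eq_self (hπ : IsStarRep π) {K : Set X} (hK : IsCompact K) :
    ∃ φ : C₀(X, ℂ), ‖φ‖ ≤ 1 ∧ ∀ S : H →L[ℂ] H, opSupport π S ⊆ K ×ˢ K →
      (π φ).comp S = S := by
  obtain ⟨K', hK', hKK'⟩ := exists_compact_superset hK
  obtain ⟨f, hf1, -, hfc, hf01⟩ := exists_continuous_one_zero_of_isCompact hK' isClosed_empty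
    (Set.disjoint_empty K')
  refine ⟨cutoff f hfc, norm_cutoff_le_one f hfc hf01, fun S hS => ?_⟩
  rw [← sub_eq_zero]
  refine hπ.eq_zero_of_comp_comp_eq_zero fun χ χ' => ?_
  have hχ : tsupport (χ * cutoff f hfc - χ) ⊆ (interior K')ᶜ := by
    refine closure_minimal (fun x hx hxK => hx ?_) isOpen_interior.isClosed_compl
    have : f x = 1 := hf1 (interior_subset hxK)
    simp [this]
  have hz : (π (χ * cutoff f hfc - χ)).comp (S.comp (π χ')) = 0 :=
    hπ.comp_comp_eq_zero fun y hy x _ hyx => hχ hy (hKK' (hS hyx).1)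
  rw [← hz, hπ.map_sub, hπ.map_mul]
  ext v
  simp

end IsStarRep

section Algebra

variable {π : C₀(X, ℂ) → H →L[ℂ] H}

lemma opSupport_comp_left_subset (hπ : IsStarRep π) (φ : C₀(X, ℂ)) (S : H →L[ℂ] H) :
    opSupport π ((π φ).comp S) ⊆ opSupport π S := by
  intro p hp U V hU hV hpU hpV
  obtain ⟨χ, ψ, hχ, hψ, h⟩ := hp U V hU hV hpU hpV
  refine ⟨χ, ψ * φ, hχ, (tsupport_mul_subset_left' _ _).trans hψ, ?_⟩
  rwa [hπ.map_mul]

lemma opSupport_comp_right_subset (hπ : IsStarRep π) (φ : C₀(X, ℂ)) (S : H →L[ℂ] H) :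
    opSupport π (S.comp (π φ)) ⊆ opSupport π S := by
  intro p hp U V hU hV hpU hpV
  obtain ⟨χ, ψ, hχ, hψ, h⟩ := hp U V hU hV hpU hpV
  refine ⟨φ * χ, ψ, (tsupport_mul_subset_right' _ _).trans hχ, hψ, ?_⟩
  rwa [hπ.map_mul]

lemma comp_left_mem_RLalg (hπ : IsStarRep π) (φ : C₀(X, ℂ)) {S : ℝ → H →L[ℂ] H}
    (hS : S ∈ RLalg π) : (fun t => (π φ).comp (S t)) ∈ RLalg π := by
  obtain ⟨⟨C, hC⟩, hcont, hcpt, ⟨K, hK, hSK⟩, hcomm⟩ := hS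
  refine ⟨⟨‖π φ‖ * C, fun t ht => ?_⟩, continuousOn_const.clm_comp hcont,
    fun t ht => (hcpt t ht).clm_comp (π φ),
    ⟨K, hK, fun t ht => (opSupport_comp_left_subset hπ φ _).trans (hSK t ht)⟩, fun χ => ?_⟩
  · exact (ContinuousLinearMap.opNorm_comp_le _ _).trans
      (mul_le_mul_of_nonneg_left (hC t ht) (norm_nonneg _))
  · refine squeeze_zero (fun _ => norm_nonneg _) (fun t => ?_)
      (by simpa using (hcomm χ).const_mul ‖π φ‖)
    rw [← ContinuousLinearMap.comp_assoc, hπ.comp_comm χ φ, ContinuousLinearMap.comp_assoc,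
      ContinuousLinearMap.comp_assoc, ← ContinuousLinearMap.comp_sub]
    exact ContinuousLinearMap.opNorm_comp_le _ _

lemma comp_right_mem_RLalg (hπ : IsStarRep π) (φ : C₀(X, ℂ)) {S : ℝ → H →L[ℂ] H}
    (hS : S ∈ RLalg π) : (fun t => (S t).comp (π φ)) ∈ RLalg π := by
  obtain ⟨⟨C, hC⟩, hcont, hcpt, ⟨K, hK, hSK⟩, hcomm⟩ := hS
  refine ⟨⟨C * ‖π φ‖, fun t ht => ?_⟩, hcont.clm_comp continuousOn_const,
    fun t ht => (hcpt t ht).comp_clm (π φ),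
    ⟨K, hK, fun t ht => (opSupport_comp_right_subset hπ φ _).trans (hSK t ht)⟩, fun χ => ?_⟩
  · exact (ContinuousLinearMap.opNorm_comp_le _ _).trans
      (mul_le_mul_of_nonneg_right (hC t ht) (norm_nonneg _))
  · refine squeeze_zero (fun _ => norm_nonneg _) (fun t => ?_)
      (by simpa using (hcomm χ).mul_const ‖π φ‖)
    rw [ContinuousLinearMap.comp_assoc, hπ.comp_comm φ χ, ← ContinuousLinearMap.comp_assoc,
      ← ContinuousLinearMap.comp_assoc, ← ContinuousLinearMap.sub_comp]
    exact ContinuousLinearMap.opNorm_comp_le _ _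

/-- A map preserving `A` that is Lipschitz for the operator norm at each time preserves the
uniform closure of `A`. -/
lemma map_mem_unifClosure {A : Set (ℝ → H →L[ℂ] H)} {F : (H →L[ℂ] H) → H →L[ℂ] H} {C : ℝ}
    (hC : 0 ≤ C) (hF : ∀ S T, ‖F T - F S‖ ≤ C * ‖T - S‖)
    (hFA : ∀ S ∈ A, (fun t => F (S t)) ∈ A) {T : ℝ → H →L[ℂ] H} (hT : T ∈ UnifClosure A) :
    (fun t => F (T t)) ∈ UnifClosure A := by
  intro ε hε
  obtain ⟨S, hS, hTS⟩ := hT (ε / (C + 1)) (by positivity)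
  refine ⟨_, hFA S hS, fun t ht => (hF _ _).trans ?_⟩
  calc C * ‖T t - S t‖ ≤ (C + 1) * (ε / (C + 1)) :=
        mul_le_mul (by linarith) (hTS t ht) (norm_nonneg _) (by positivity)
    _ = ε := by field_simp

lemma comp_left_mem_RLc (hπ : IsStarRep π) (φ : C₀(X, ℂ)) {T : ℝ → H →L[ℂ] H}
    (hT : T ∈ RLc π) : (fun t => (π φ).comp (T t)) ∈ RLc π :=
  map_mem_unifClosure (F := fun A => (π φ).comp A) (norm_nonneg (π φ))
    (fun S T => by
      rw [← ContinuousLinearMap.comp_sub]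
      exact ContinuousLinearMap.opNorm_comp_le _ _)
    (fun _ => comp_left_mem_RLalg hπ φ) hT

lemma comp_right_mem_RLc (hπ : IsStarRep π) (φ : C₀(X, ℂ)) {T : ℝ → H →L[ℂ] H}
    (hT : T ∈ RLc π) : (fun t => (T t).comp (π φ)) ∈ RLc π :=
  map_mem_unifClosure (F := fun A => A.comp (π φ)) (norm_nonneg (π φ))
    (fun S T => by
      rw [← ContinuousLinearMap.sub_comp, mul_comm]
      exact ContinuousLinearMap.opNorm_comp_le _ _)
    (fun _ => comp_right_mem_RLalg hπ φ) hT

lemma continuousOn_of_mem_RLc {T : ℝ → H →L[ℂ] H} (hT : T ∈ RLc π) :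
    ContinuousOn T (Set.Ici 1) := by
  refine continuousOn_of_uniform_approx_of_continuousOn fun u hu => ?_
  obtain ⟨ε, hε, hεu⟩ := Metric.mem_uniformity_dist.1 hu
  obtain ⟨S, hS, hTS⟩ := hT (ε / 2) (half_pos hε)
  refine ⟨S, hS.2.1, fun t ht => hεu ?_⟩
  rw [dist_eq_norm]
  exact (hTS t ht).trans_lt (half_lt_self hε)

lemma isCompactOperator_of_mem_RLc {T : ℝ → H →L[ℂ] H} (hT : T ∈ RLc π) {t : ℝ} (ht : 1 ≤ t) :
    IsCompactOperator (T t) := by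
  have hcl : T t ∈ closure {A : H →L[ℂ] H | IsCompactOperator A} := by
    rw [Metric.mem_closure_iff]
    intro ε hε
    obtain ⟨S, hS, hTS⟩ := hT (ε / 2) (half_pos hε)
    refine ⟨S t, hS.2.2.1 t ht, ?_⟩
    rw [dist_eq_norm]
    exact (hTS t ht).trans_lt (half_lt_self hε)
  rwa [isClosed_setOfPred_isCompactOperator.closure_eq] at hcl

lemma commDecay_of_mem_RLc {T : ℝ → H →L[ℂ] H} (hT : T ∈ RLc π) : CommDecay π T := by
  intro φ
  rw [Metric.tendsto_atTop']
  intro ε hε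
  set C := ‖π φ‖
  have hC0 : 0 ≤ C := norm_nonneg _
  obtain ⟨S, hS, hTS⟩ := hT (ε / (4 * (C + 1))) (by positivity)
  obtain ⟨N, hN⟩ := (Metric.tendsto_atTop'.1 (hS.2.2.2.2 φ)) (ε / 2) (half_pos hε)
  refine ⟨max N 1, fun t ht => ?_⟩
  have h1 := hTS t ((le_max_right N 1).trans ht.lt.le)
  have h2 := hN t ((le_max_left N 1).trans_lt ht)
  rw [dist_zero_right, norm_norm] at h2 ⊢
  have h3 : (π φ).comp (T t) - (T t).comp (π φ) = (π φ).comp (T t - S t)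
      - (T t - S t).comp (π φ) + ((π φ).comp (S t) - (S t).comp (π φ)) := by
    rw [ContinuousLinearMap.comp_sub, ContinuousLinearMap.sub_comp]
    abel
  have h4 : C * ‖T t - S t‖ ≤ ε / 4 := by
    calc C * ‖T t - S t‖ ≤ (C + 1) * (ε / (4 * (C + 1))) :=
          mul_le_mul (by linarith) h1 (norm_nonneg _) (by positivity)
      _ = ε / 4 := by field_simp
  have h5 : ‖(π φ).comp (T t - S t)‖ ≤ C * ‖T t - S t‖ := ContinuousLinearMap.opNorm_comp_le _ _
  have h6 : ‖(T t - S t).comp (π φ)‖ ≤ C * ‖T t - S t‖ := by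
    rw [mul_comm]
    exact ContinuousLinearMap.opNorm_comp_le _ _
  rw [h3]
  have h7 := norm_add_le ((π φ).comp (T t - S t) - (T t - S t).comp (π φ))
    ((π φ).comp (S t) - (S t).comp (π φ))
  have h8 := norm_sub_le ((π φ).comp (T t - S t)) ((T t - S t).comp (π φ))
  linarith

lemma exists_norm_comp_sub_lt [T2Space X] [LocallyCompactSpace X] (hπ : IsStarRep π)
    {T : ℝ → H →L[ℂ] H} (hT : T ∈ RLc π) {ε : ℝ} (hε : 0 < ε) :
    ∃ φ : C₀(X, ℂ), ∀ t : ℝ, 1 ≤ t → ‖(π φ).comp (T t) - T t‖ < ε := by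
  obtain ⟨S, ⟨-, -, -, ⟨K, hK, hSK⟩, -⟩, hTS⟩ := hT (ε / 4) (by positivity)
  obtain ⟨φ, hφ, hφS⟩ := hπ.exists_comp_eq_self hK
  refine ⟨φ, fun t ht => ?_⟩
  have h1 := hTS t ht
  have h2 : (π φ).comp (T t) - T t = (π φ).comp (T t - S t) - (T t - S t) := by
    rw [ContinuousLinearMap.comp_sub, hφS _ (hSK t ht)]
    abel
  have h3 : ‖(π φ).comp (T t - S t)‖ ≤ ‖T t - S t‖ :=
    (ContinuousLinearMap.opNorm_comp_le _ _).trans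
      (mul_le_of_le_one_left (norm_nonneg _) ((hπ.norm_apply_le φ).trans hφ))
  rw [h2]
  linarith [norm_sub_le ((π φ).comp (T t - S t)) (T t - S t)]

end Algebra

/-- for `T ∈ RL^*_c(H_X)` and `φ ∈ C₀(X)`, the products `φT` and `Tφ` lie in
`RL^*_c(H_X)`; the commutator `t ↦ [φ, T_t]` lies in `C₀([1,∞), 𝒦(H))` (it is continuous,
compact-operator valued, and vanishes in norm at infinity); and `T` can be approximated in
norm by `φT`.  (These facts say precisely that the quotient
`RL^*_{c,Q}(H_X) = RL^*_c(H_X) / C₀([1,∞), 𝒦(H_X))` is a `C₀(X)`-algebra: the induced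
representation of `C₀(X)` on its multiplier algebra is central and nondegenerate.) -/
theorem statement3
    {X : Type*} [TopologicalSpace X] [T2Space X] [LocallyCompactSpace X]
    [SecondCountableTopology X]
    {H : Type*} [NormedAddCommGroup H] [InnerProductSpace ℂ H] [CompleteSpace H]
    [SecondCountableTopology H]
    (π : C₀(X, ℂ) → H →L[ℂ] H) (hπ : IsStarRep π) :
    ∀ T ∈ RLc π,
      -- `φT, Tφ ∈ RL^*_c(H_X)`
      (∀ φ : C₀(X, ℂ),
        (fun t => (π φ).comp (T t)) ∈ RLc π ∧ (fun t => (T t).comp (π φ)) ∈ RLc π) ∧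
      -- centrality: `t ↦ [φ, T_t]` lies in `C₀([1,∞), 𝒦(H_X))`
      (∀ φ : C₀(X, ℂ),
        ContinuousOn (fun t => (π φ).comp (T t) - (T t).comp (π φ)) (Set.Ici 1) ∧
        (∀ t : ℝ, 1 ≤ t → IsCompactOperator ⇑((π φ).comp (T t) - (T t).comp (π φ))) ∧
        Tendsto (fun t => ‖(π φ).comp (T t) - (T t).comp (π φ)‖) atTop (𝓝 0)) ∧
      -- nondegeneracy: `‖φT - T‖ < ε` for suitable `φ ∈ C₀(X)`
      (∀ ε > (0 : ℝ), ∃ φ : C₀(X, ℂ), ∀ t : ℝ, 1 ≤ t →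
        ‖(π φ).comp (T t) - T t‖ < ε) := by
  intro T hT
  refine ⟨fun φ => ⟨comp_left_mem_RLc hπ φ hT, comp_right_mem_RLc hπ φ hT⟩, fun φ => ⟨?_, ?_, ?_⟩,
    fun ε hε => exists_norm_comp_sub_lt hπ hT hε⟩
  · exact (continuousOn_of_mem_RLc (comp_left_mem_RLc hπ φ hT)).sub
      (continuousOn_of_mem_RLc (comp_right_mem_RLc hπ φ hT))
  · intro t ht
    have hc := isCompactOperator_of_mem_RLc hT ht
    exact (hc.clm_comp (π φ)).sub (hc.comp_clm (π φ))
  · exact commDecay_of_mem_RLc hT φ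

end Stmt
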